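/- arXiv:2403.14363 — 2 statements merged into one kernel-verified Lean document; each statement's English description precedes it below -/
import Mathlib

section
/- Let α, β be finite types, n ≥ 2, L ≥ 1, and let {(η i, ρ i)}_{i ∈ Fin n} be an ensemble of density matrices on Matrix (α × β) (α × β) ℂ. Suppose Q : ℝ satisfies ∑ i, η i * (Tr (Γ(ρ i) * N i)).re ≤ Q for every POVM N with n outcomes on the single-copy space. Then for every POVM M with n outcomes on the L-fold space (indexed by Fin L → α × β), ∑ i, η_i^{(L)} * (Tr (Γ(ρ_i^{(L)}) * M i)).re ≤ 1/n + ((n−1)/n) * (n*Q − 1)^L. -/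
open Matrix BigOperators
open scoped ComplexOrder

/-- A POVM with `n` outcomes: each element is positive semidefinite and they sum to the identity. -/
def IsPOVM {ι : Type*} [Fintype ι] [DecidableEq ι] {n : ℕ} (M : Fin n → Matrix ι ι ℂ) : Prop :=
  (∀ i, (M i).PosSemidef) ∧ ∑ i, M i = 1

/-- Partial transposition (with respect to the second subsystem) on a bipartite system. -/
def ptAB {α β : Type*} (ρ : Matrix (α × β) (α × β) ℂ) : Matrix (α × β) (α × β) ℂ :=
  Matrix.of fun p q => ρ (p.1, q.2) (q.1, p.2)

/-- Probability of the string `c` in the `L`-fold ensemble. -/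
def etaC {n : ℕ} (L : ℕ) (η : Fin n → ℝ) (c : Fin L → Fin n) : ℝ := ∏ l, η (c l)

/-- The `L`-fold tensor-product state labelled by the string `c`. -/
def rhoC {ι : Type*} {n : ℕ} (L : ℕ) (ρ : Fin n → Matrix ι ι ℂ) (c : Fin L → Fin n) :
    Matrix (Fin L → ι) (Fin L → ι) ℂ :=
  Matrix.of fun x y => ∏ l, ρ (c l) (x l) (y l)

/-- The modulo-`n` sum of the entries of `c`. -/
def omg {n : ℕ} (L : ℕ) (hn : 0 < n) (c : Fin L → Fin n) : Fin n :=
  ⟨(∑ l, (c l).val) % n, Nat.mod_lt _ hn⟩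

/-- The probability `η_i^{(L)}` of the grouped `L`-fold ensemble. -/
def etaL {n : ℕ} (L : ℕ) (hn : 0 < n) (η : Fin n → ℝ) (i : Fin n) : ℝ :=
  ∑ c ∈ Finset.univ.filter (fun c : Fin L → Fin n => omg L hn c = i), etaC L η c

/-- The state `ρ_i^{(L)}` of the grouped `L`-fold ensemble. -/
noncomputable def rhoL {ι : Type*} {n : ℕ} (L : ℕ) (hn : 0 < n) (η : Fin n → ℝ)
    (ρ : Fin n → Matrix ι ι ℂ) (i : Fin n) : Matrix (Fin L → ι) (Fin L → ι) ℂ :=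
  (etaL L hn η i)⁻¹ •
    ∑ c ∈ Finset.univ.filter (fun c : Fin L → Fin n => omg L hn c = i), etaC L η c • rhoC L ρ c

/-- Partial transposition on the `L`-fold bipartite space. -/
def ptL {α β : Type*} (L : ℕ) (σ : Matrix (Fin L → α × β) (Fin L → α × β) ℂ) :
    Matrix (Fin L → α × β) (Fin L → α × β) ℂ :=
  Matrix.of fun x y => σ (fun l => ((x l).1, (y l).2)) (fun l => ((y l).1, (x l).2))

section Duality

variable {ι : Type*} [Fintype ι] [DecidableEq ι]

omit [DecidableEq ι] in
lemma Matrix.re_trace_conjTranspose_mul (A X : Matrix ι ι ℂ) :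
    (Aᴴ * X).trace.re = (A * Xᴴ).trace.re := by
  have h : Aᴴ * X = (Xᴴ * A)ᴴ := by simp [conjTranspose_mul]
  rw [h, trace_conjTranspose, trace_mul_comm, Complex.star_def, Complex.conj_re]

open scoped MatrixOrder in
omit [DecidableEq ι] in
lemma Matrix.PosSemidef.re_trace_mul_nonneg {A B : Matrix ι ι ℂ} (hA : A.PosSemidef)
    (hB : B.PosSemidef) : 0 ≤ (A * B).trace.re := by
  classical
  obtain ⟨C, rfl⟩ := CStarAlgebra.nonneg_iff_eq_star_mul_self.mp hB.nonneg
  rw [star_eq_conjTranspose, ← Matrix.mul_assoc, trace_mul_comm, ← Matrix.mul_assoc]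
  exact (Complex.nonneg_iff.mp (hA.mul_mul_conjTranspose_same C).trace_nonneg).1

open scoped MatrixOrder Matrix.Norms.L2Operator in
lemma Matrix.IsHermitian.exists_add_smul_one_posSemidef {X : Matrix ι ι ℂ}
    (hX : X.IsHermitian) : ∃ r : ℝ, (X + r • (1 : Matrix ι ι ℂ)).PosSemidef := by
  have h := IsSelfAdjoint.neg_algebraMap_norm_le_self (a := X) hX
  refine ⟨‖X‖, ?_⟩
  rw [Matrix.le_iff] at h
  rwa [sub_neg_eq_add, Algebra.algebraMap_eq_smul_one] at h

/-- Every real-linear functional on complex matrices is of the form `X ↦ Re Tr (K X)`. -/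
lemma Matrix.exists_eq_re_trace_mul (φ : Matrix ι ι ℂ →ₗ[ℝ] ℝ) :
    ∃ K : Matrix ι ι ℂ, ∀ X, φ X = (K * X).trace.re := by
  refine ⟨of fun j i => ⟨φ (single i j 1), -φ (single i j Complex.I)⟩, fun X => ?_⟩
  have hs : ∀ i j, single i j (X i j)
      = (X i j).re • single i j (1 : ℂ) + (X i j).im • single i j Complex.I := by
    intro i j
    rw [smul_single, smul_single, ← single_add]
    congr 1
    simp [Complex.re_add_im]
  conv_lhs => rw [matrix_eq_sum_single X]
  simp only [map_sum, hs, map_add, map_smul, smul_eq_mul, trace, diag_apply, mul_apply, of_apply,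
    Complex.re_sum, Complex.mul_re]
  rw [Finset.sum_comm]
  exact Finset.sum_congr rfl fun j _ => Finset.sum_congr rfl fun i _ => by ring

omit [DecidableEq ι] in
lemma Matrix.posSemidef_of_re_trace_mul_nonneg {A : Matrix ι ι ℂ} (hA : A.IsHermitian)
    (h : ∀ N : Matrix ι ι ℂ, N.PosSemidef → 0 ≤ (A * N).trace.re) : A.PosSemidef := by
  refine .of_dotProduct_mulVec_nonneg hA fun x => ?_
  have hx := h _ (posSemidef_vecMulVec_self_star x)
  rw [mul_vecMulVec, trace_vecMulVec, dotProduct_comm] at hx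
  exact Complex.nonneg_iff.mpr ⟨hx, (hA.im_star_dotProduct_mulVec_self x).symm⟩

/-- Families of matrices whose Hermitian parts are positive semidefinite. -/
def realPartPosSemidefCone (n : ℕ) (ι : Type*) [Fintype ι] :
    PointedCone ℝ (Fin n → Matrix ι ι ℂ) where
  carrier := {N | ∀ i, (N i + (N i)ᴴ).PosSemidef}
  add_mem' {a b} ha hb i := by
    have h := (ha i).add (hb i)
    convert h using 1
    simp only [Pi.add_apply, conjTranspose_add]
    abel
  zero_mem' i := by simpa using PosSemidef.zero
  smul_mem' c a ha i := by
    change ((c : ℝ) • a i + ((c : ℝ) • a i)ᴴ).PosSemidef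
    rw [conjTranspose_smul, star_trivial, ← smul_add]
    exact (ha i).smul c.2

/-- Families of matrices whose sum has Hermitian part a real multiple of the identity. -/
def realPartSumScalar (n : ℕ) (ι : Type*) [Fintype ι] [DecidableEq ι] :
    Submodule ℝ (Fin n → Matrix ι ι ℂ) where
  carrier := {N | ∃ r : ℝ, ∑ i, (N i + (N i)ᴴ) = r • (1 : Matrix ι ι ℂ)}
  add_mem' := by
    rintro a b ⟨r, hr⟩ ⟨s, hs⟩
    refine ⟨r + s, ?_⟩
    rw [add_smul, ← hr, ← hs, ← Finset.sum_add_distrib]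
    refine Finset.sum_congr rfl fun i _ => ?_
    simp only [Pi.add_apply, conjTranspose_add]
    abel
  zero_mem' := ⟨0, by simp⟩
  smul_mem' := by
    rintro c a ⟨r, hr⟩
    refine ⟨c * r, ?_⟩
    rw [mul_smul, ← hr, Finset.smul_sum]
    refine Finset.sum_congr rfl fun i _ => ?_
    simp [conjTranspose_smul]

/-- The gap `q Tr (∑ N i) - ∑ Tr (A i * N i)` (real parts) as a linear functional. -/
noncomputable def povmGap {n : ℕ} (q : ℝ) (A : Fin n → Matrix ι ι ℂ) :
    (Fin n → Matrix ι ι ℂ) →ₗ[ℝ] ℝ where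
  toFun N := q * (∑ i, N i).trace.re - ∑ i, (A i * N i).trace.re
  map_add' a b := by
    simp only [Pi.add_apply, Finset.sum_add_distrib, trace_add, Complex.add_re, mul_add]
    ring
  map_smul' c a := by
    simp only [Pi.smul_apply, ← Finset.smul_sum, trace_smul, Matrix.mul_smul, Complex.smul_re,
      smul_eq_mul, RingHom.id_apply, mul_sub, ← Finset.mul_sum]
    ring

lemma povmGap_nonneg [Nonempty ι] {n : ℕ} {A : Fin n → Matrix ι ι ℂ}
    (hA : ∀ i, (A i).IsHermitian) {Q : ℝ}
    (hQ : ∀ N : Fin n → Matrix ι ι ℂ, IsPOVM N → ∑ i, (A i * N i).trace.re ≤ Q)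
    {N : Fin n → Matrix ι ι ℂ} (hW : N ∈ realPartSumScalar n ι)
    (hN : N ∈ realPartPosSemidefCone n ι) :
    0 ≤ povmGap (Q / Fintype.card ι) A N := by
  obtain ⟨r, hr⟩ := hW
  replace hN : ∀ i, (N i + (N i)ᴴ).PosSemidef := hN
  have hd : (0 : ℝ) < Fintype.card ι := by exact_mod_cast Fintype.card_pos
  have htr : (∑ i, (N i + (N i)ᴴ)).trace = ((r * Fintype.card ι : ℝ) : ℂ) := by
    rw [hr]; simp
  have hsum : 2 * (∑ i, N i).trace.re = r * Fintype.card ι := by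
    have := congrArg Complex.re htr
    rw [Complex.ofReal_re, Finset.sum_add_distrib, trace_add, ← conjTranspose_sum,
      trace_conjTranspose] at this
    simp only [Complex.add_re, Complex.star_def, Complex.conj_re] at this
    linarith
  have hAN : ∀ i, (A i * (N i + (N i)ᴴ)).trace.re = 2 * (A i * N i).trace.re := by
    intro i
    rw [Matrix.mul_add, trace_add, Complex.add_re, ← re_trace_conjTranspose_mul, (hA i).eq]
    ring
  have hr0 : 0 ≤ r := by
    have h := (posSemidef_sum Finset.univ fun i _ => hN i).trace_nonneg
    rw [htr, Complex.zero_le_real] at h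
    exact nonneg_of_mul_nonneg_left h hd
  have key : ∑ i, (A i * (N i + (N i)ᴴ)).trace.re ≤ r * Q := by
    rcases hr0.eq_or_lt with h0 | hpos
    · have hz : ∀ i, N i + (N i)ᴴ = 0 := by
        intro i
        rw [← (hN i).trace_eq_zero_iff]
        rw [← h0, zero_mul, trace_sum, Complex.ofReal_zero,
          Finset.sum_eq_zero_iff_of_nonneg fun i _ => (hN i).trace_nonneg] at htr
        exact htr i (Finset.mem_univ i)
      simp [hz, ← h0]
    · have h := hQ (fun i => r⁻¹ • (N i + (N i)ᴴ))
        ⟨fun i => (hN i).smul (inv_nonneg.mpr hr0), by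
          rw [← Finset.smul_sum, hr, smul_smul, inv_mul_cancel₀ hpos.ne', one_smul]⟩
      simp only [Matrix.mul_smul, trace_smul, Complex.smul_re, smul_eq_mul,
        ← Finset.mul_sum] at h
      rwa [inv_mul_le_iff₀ hpos] at h
  simp only [hAN, ← Finset.mul_sum] at key
  change 0 ≤ Q / Fintype.card ι * (∑ i, N i).trace.re - ∑ i, (A i * N i).trace.re
  have : Q / Fintype.card ι * (∑ i, N i).trace.re = r * Q / 2 := by
    field_simp
    linear_combination Q * hsum
  linarith

/-- Strong duality for minimum-error discrimination: the optimal value over POVMs is attained by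
a common upper bound of the operators. -/
lemma exists_upper_bound_of_povm_le [Nonempty ι] {n : ℕ} (hn : 0 < n) {A : Fin n → Matrix ι ι ℂ}
    (hA : ∀ i, (A i).IsHermitian) {Q : ℝ}
    (hQ : ∀ N : Fin n → Matrix ι ι ℂ, IsPOVM N → ∑ i, (A i * N i).trace.re ≤ Q) :
    ∃ H : Matrix ι ι ℂ, (∀ i, (H - A i).PosSemidef) ∧ H.trace = (Q : ℂ) := by
  have hd : (Fintype.card ι : ℝ) ≠ 0 := by exact_mod_cast Fintype.card_ne_zero
  obtain ⟨g, hgf, hgs⟩ := riesz_extension (realPartPosSemidefCone n ι)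
    ((povmGap (Q / Fintype.card ι) A).toPMap (realPartSumScalar n ι))
    (fun x hx => povmGap_nonneg hA hQ x.2 hx) (by
      intro y
      choose r hr using fun i =>
        (isHermitian_add_transpose_self (y i)).exists_add_smul_one_posSemidef
      obtain ⟨R, hR⟩ := Finite.exists_le r
      refine ⟨⟨fun _ => (R / 2) • 1, n * R, ?_⟩, fun i => ?_⟩
      · ext x y
        simp [conjTranspose_smul, ← add_smul, mul_assoc]
      · have h := (hr i).add (PosSemidef.one.smul (sub_nonneg.mpr (hR i)))
        convert h using 1
        simp only [Pi.add_apply, conjTranspose_add, conjTranspose_smul, conjTranspose_one,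
          star_trivial]
        module)
  replace hgf : ∀ N ∈ realPartSumScalar n ι, g N = povmGap (Q / Fintype.card ι) A N :=
    fun N hN => hgf ⟨N, hN⟩
  have hgap : ∀ i X, povmGap (Q / Fintype.card ι) A (Pi.single i X)
      = Q / Fintype.card ι * X.trace.re - (A i * X).trace.re := by
    intro i X
    change _ * (∑ j, (Pi.single i X : Fin n → Matrix ι ι ℂ) j).trace.re
      - ∑ j, (A j * (Pi.single i X : Fin n → Matrix ι ι ℂ) j).trace.re = _
    rw [Finset.sum_pi_single', if_pos (Finset.mem_univ i),
      Finset.sum_eq_single i (fun j _ hj => by simp [Pi.single_eq_of_ne hj]) (by simp)]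
    simp
  have hmem : ∀ i X (r : ℝ), X + Xᴴ = r • (1 : Matrix ι ι ℂ) →
      (Pi.single i X : Fin n → Matrix ι ι ℂ) ∈ realPartSumScalar n ι := by
    intro i X r h
    refine ⟨r, ?_⟩
    rw [Finset.sum_eq_single i (fun j _ hj => by simp [Pi.single_eq_of_ne hj]) (by simp)]
    simpa using h
  let φ : Matrix ι ι ℂ →ₗ[ℝ] ℝ :=
    { toFun X := g (Pi.single ⟨0, hn⟩ X) + (A ⟨0, hn⟩ * X).trace.re
      map_add' X Y := by
        simp only [Pi.single_add, map_add, Matrix.mul_add, trace_add, Complex.add_re]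
        ring
      map_smul' c X := by
        simp only [Pi.single_smul, map_smul, Matrix.mul_smul, trace_smul, Complex.smul_re,
          smul_eq_mul, RingHom.id_apply, mul_add] }
  have hφ : ∀ i X, φ X = g (Pi.single i X) + (A i * X).trace.re := by
    intro i X
    have h := hgf (Pi.single ⟨0, hn⟩ X - Pi.single i X) ⟨0, by
      simp [Finset.sum_add_distrib, ← conjTranspose_sum, Finset.sum_sub_distrib]⟩
    rw [map_sub, map_sub, hgap, hgap] at h
    change g (Pi.single ⟨0, hn⟩ X) + (A ⟨0, hn⟩ * X).trace.re = _
    linarith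
  have hφW : ∀ X (r : ℝ), X + Xᴴ = r • (1 : Matrix ι ι ℂ) →
      φ X = Q / Fintype.card ι * X.trace.re := by
    intro X r h
    rw [hφ ⟨0, hn⟩, hgf _ (hmem _ X r h), hgap]
    ring
  have hφstar : ∀ X, φ Xᴴ = φ X := by
    intro X
    have h := hφW (X - Xᴴ) 0 (by simp)
    rw [map_sub, trace_sub, trace_conjTranspose, Complex.sub_re, Complex.star_def,
      Complex.conj_re] at h
    linarith
  obtain ⟨K, hK⟩ := exists_eq_re_trace_mul φ
  have hH : ∀ X, (((1 / 2 : ℝ) • (K + Kᴴ)) * X).trace.re = φ X := by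
    intro X
    rw [Matrix.smul_mul, Matrix.add_mul, trace_smul, trace_add, Complex.smul_re, Complex.add_re,
      re_trace_conjTranspose_mul, ← hK, ← hK, hφstar, smul_eq_mul]
    ring
  have hHh : ((1 / 2 : ℝ) • (K + Kᴴ)).IsHermitian := by
    rw [IsHermitian, conjTranspose_smul, star_trivial, conjTranspose_add,
      conjTranspose_conjTranspose, add_comm]
  refine ⟨(1 / 2 : ℝ) • (K + Kᴴ), fun i => ?_, ?_⟩
  · refine posSemidef_of_re_trace_mul_nonneg (hHh.sub (hA i)) fun N hN => ?_
    have h : 0 ≤ g (Pi.single i N) := hgs _ fun j => by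
      by_cases hj : j = i
      · subst hj
        simpa using hN.add hN.conjTranspose
      · simpa [Pi.single_eq_of_ne hj] using PosSemidef.zero
    rw [Matrix.sub_mul, trace_sub, Complex.sub_re, hH, hφ i]
    linarith
  · have h1 := hφW 1 2 (by rw [conjTranspose_one, two_smul])
    rw [← hH, Matrix.mul_one, trace_one, Complex.natCast_re, div_mul_cancel₀ _ hd] at h1
    have h2 : star ((1 / 2 : ℝ) • (K + Kᴴ)).trace = ((1 / 2 : ℝ) • (K + Kᴴ)).trace := by
      rw [← trace_conjTranspose, hHh.eq]
    rw [← h1]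
    exact (Complex.conj_eq_iff_re.mp h2).symm

end Duality

section Tensor

/-- The tensor product of a family of matrices, indexed by `Fin L → ι`. -/
def tensorFamily {ι : Type*} {L : ℕ} (B : Fin L → Matrix ι ι ℂ) :
    Matrix (Fin L → ι) (Fin L → ι) ℂ :=
  of fun x y => ∏ l, B l (x l) (y l)

/-- The sum of `⨂ l, A (c l)` over the strings `c` with sum `k` modulo `n`. -/
def groupedTensor {ι : Type*} {n : ℕ} (L : ℕ) (hn : 0 < n) (A : Fin n → Matrix ι ι ℂ) (k : Fin n) :
    Matrix (Fin L → ι) (Fin L → ι) ℂ :=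
  ∑ c ∈ Finset.univ.filter (fun c : Fin L → Fin n => omg L hn c = k),
    tensorFamily fun l => A (c l)

variable {ι : Type*}

lemma trace_tensorFamily [Fintype ι] {L : ℕ} (B : Fin L → Matrix ι ι ℂ) :
    (tensorFamily B).trace = ∏ l, (B l).trace := by
  classical
  simp only [trace, diag_apply, Fintype.prod_sum]
  rfl

lemma tensorFamily_succ_apply {L : ℕ} (B : Fin (L + 1) → Matrix ι ι ℂ) (x y : Fin (L + 1) → ι) :
    tensorFamily B x y
      = B 0 (x 0) (y 0) * tensorFamily (Fin.tail B) (Fin.tail x) (Fin.tail y) :=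
  Fin.prod_univ_succ _

lemma sum_groupedTensor {n : ℕ} (L : ℕ) (hn : 0 < n) (A : Fin n → Matrix ι ι ℂ) :
    ∑ k, groupedTensor L hn A k = tensorFamily fun _ : Fin L => ∑ i, A i := by
  simp only [groupedTensor, Finset.sum_fiberwise]
  ext x y
  simp only [Matrix.sum_apply, tensorFamily, of_apply, Fintype.prod_sum]

lemma omg_succ {n : ℕ} [NeZero n] (L : ℕ) (hn : 0 < n) (i : Fin n) (c : Fin L → Fin n) :
    omg (L + 1) hn (Fin.cons i c) = i + omg L hn c := by
  ext
  simp [omg, Fin.sum_univ_succ, Fin.val_add]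

lemma groupedTensor_succ_apply {n : ℕ} [NeZero n] (L : ℕ) (hn : 0 < n)
    (A : Fin n → Matrix ι ι ℂ) (k : Fin n) (x y : Fin (L + 1) → ι) :
    groupedTensor (L + 1) hn A k x y
      = ∑ i, A i (x 0) (y 0) * groupedTensor L hn A (k - i) (Fin.tail x) (Fin.tail y) := by
  simp only [groupedTensor, Matrix.sum_apply, Finset.sum_filter, Finset.mul_sum]
  rw [← (Fin.consEquiv fun _ => Fin n).sum_comp, Fintype.sum_prod_type]
  refine Finset.sum_congr rfl fun i _ => Finset.sum_congr rfl fun c _ => ?_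
  have hk : omg (L + 1) hn (Fin.consEquiv (fun _ => Fin n) (i, c)) = k ↔ omg L hn c = k - i := by
    rw [eq_sub_iff_add_eq', ← omg_succ]
    rfl
  simp only [hk]
  split_ifs
  · exact tensorFamily_succ_apply _ x y
  · simp

lemma sum_sub_mul_shift_eq {n : ℕ} [NeZero n] (f g : Fin n → ℂ) (h v e : ℂ) (k : Fin n) :
    ∑ i, (h - f i) * (v + e * (g (k - i) - (n : ℂ)⁻¹ * ∑ j, g j))
      = (n * h - ∑ i, f i) * v
        - e * (∑ i, f i * g (k - i) - (∑ i, f i) * ((n : ℂ)⁻¹ * ∑ j, g j)) := by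
  have hn : (n : ℂ) ≠ 0 := NeZero.ne _
  have hs : ∑ i, g (k - i) = ∑ j, g j := (Equiv.subLeft k).sum_comp g
  have : ∀ i, (h - f i) * (v + e * (g (k - i) - (n : ℂ)⁻¹ * ∑ j, g j))
      = (h * v - h * e * ((n : ℂ)⁻¹ * ∑ j, g j)) + h * e * g (k - i) - f i * v
        - e * (f i * g (k - i)) + f i * (e * ((n : ℂ)⁻¹ * ∑ j, g j)) := fun i => by ring
  simp only [this, Finset.sum_add_distrib, Finset.sum_sub_distrib, ← Finset.mul_sum,
    ← Finset.sum_mul, hs, Finset.sum_const, Finset.card_univ, Fintype.card_fin, nsmul_eq_mul]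
  field_simp
  ring

open scoped Kronecker in
/-- If `H` dominates every `A i`, then the deviation of the grouped tensors from their mean is
bounded, up to either sign, by a multiple of `(n H - ∑ A i)^{⊗ L}`. -/
lemma posSemidef_groupedTensor_bound [Fintype ι] {n : ℕ} (hn2 : 2 ≤ n) (hn : 0 < n)
    {A : Fin n → Matrix ι ι ℂ} {H : Matrix ι ι ℂ} (hH : ∀ i, (H - A i).PosSemidef) (L : ℕ) :
    ∀ (k : Fin n) (e : ℝ), e = 1 ∨ e = -1 →
      (((n - 1 : ℝ) / n) • tensorFamily (fun _ : Fin L => n • H - ∑ i, A i)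
        + e • (groupedTensor L hn A k
          - (n : ℝ)⁻¹ • tensorFamily fun _ : Fin L => ∑ i, A i)).PosSemidef := by
  have : NeZero n := ⟨hn.ne'⟩
  induction L with
  | zero =>
    intro k e he
    have hn1 : (2 : ℝ) ≤ n := by exact_mod_cast hn2
    set s : ℝ := (n - 1 : ℝ) / n + e * ((if (0 : Fin n) = k then 1 else 0) - (n : ℝ)⁻¹) with hs
    have hs0 : 0 ≤ s := by
      have : s = ((n - 1) + e * ((if (0 : Fin n) = k then (n : ℝ) else 0) - 1)) / n := by
        rw [hs]
        split_ifs
        · field_simp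
        · field_simp
          ring
      rw [this]
      apply div_nonneg _ (by positivity)
      rcases he with rfl | rfl <;> split_ifs <;> linarith
    have ho : ∀ c : Fin 0 → Fin n, omg 0 hn c = 0 := fun c => by ext; simp [omg]
    convert (PosSemidef.one (n := Fin 0 → ι) (R := ℂ)).smul hs0 using 1
    ext x y
    obtain rfl := Subsingleton.elim x y
    simp only [groupedTensor, tensorFamily, ho, hs]
    split_ifs <;> simp [*]
  | succ L ih =>
    intro k e he
    have hpos := posSemidef_sum Finset.univ fun i _ => ((hH i).kronecker
      (ih (k - i) (-e) (by rcases he with rfl | rfl <;> simp))).submatrix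
        fun x : Fin (L + 1) → ι => (x 0, Fin.tail x)
    refine Eq.mpr (congrArg PosSemidef ?_) hpos
    ext x y
    have hS : ∀ x y : Fin L → ι, tensorFamily (fun _ : Fin L => ∑ i, A i) x y
        = ∑ k, groupedTensor L hn A k x y := fun x y => by
      rw [← sum_groupedTensor L hn, Matrix.sum_apply]
    have h := sum_sub_mul_shift_eq (fun i => A i (x 0) (y 0))
      (fun j => groupedTensor L hn A j (Fin.tail x) (Fin.tail y)) (H (x 0) (y 0))
      (((n - 1 : ℝ) / n : ℝ) * tensorFamily (fun _ : Fin L => n • H - ∑ i, A i)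
        (Fin.tail x) (Fin.tail y)) ((-e : ℝ) : ℂ) k
    rw [← hS] at h
    simp only [Matrix.add_apply, Matrix.sub_apply, Matrix.smul_apply,
      Matrix.sum_apply, submatrix_apply, kroneckerMap_apply,
      Complex.real_smul, groupedTensor_succ_apply, tensorFamily_succ_apply, nsmul_eq_mul]
    simp only [Fin.tail_def] at h ⊢
    push_cast at h ⊢
    refine Eq.trans ?_ h.symm
    ring

end Tensor

lemma ptL_tensorFamily {α β : Type*} {L : ℕ} (B : Fin L → Matrix (α × β) (α × β) ℂ) :
    ptL L (tensorFamily B) = tensorFamily fun l => ptAB (B l) := rfl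

lemma etaL_smul_ptL_rhoL {α β : Type*} {n : ℕ} (L : ℕ) (hn : 0 < n) {η : Fin n → ℝ}
    (hη : ∀ i, 0 < η i) (ρ : Fin n → Matrix (α × β) (α × β) ℂ) (k : Fin n) :
    etaL L hn η k • ptL L (rhoL L hn η ρ k) = groupedTensor L hn (fun i => η i • ptAB (ρ i)) k := by
  have h : etaL L hn η k • rhoL L hn η ρ k
      = groupedTensor L hn (fun i => η i • ρ i) k := by
    have hsum : ∑ c ∈ Finset.univ.filter (fun c : Fin L → Fin n => omg L hn c = k),
        etaC L η c • rhoC L ρ c = groupedTensor L hn (fun i => η i • ρ i) k := by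
      refine Finset.sum_congr rfl fun c _ => ?_
      ext x y
      simp [etaC, rhoC, tensorFamily, Finset.prod_mul_distrib]
    rw [rhoL, hsum]
    by_cases h0 : etaL L hn η k = 0
    · have hpos : ∀ c : Fin L → Fin n, 0 < etaC L η c := fun c =>
        Finset.prod_pos fun l _ => hη (c l)
      have hempty : Finset.univ.filter (fun c : Fin L → Fin n => omg L hn c = k) = ∅ := by
        by_contra hne
        exact (Finset.sum_pos (fun c _ => hpos c) (Finset.nonempty_iff_ne_empty.mpr hne)).ne' h0
      rw [h0, zero_smul, groupedTensor, hempty, Finset.sum_empty]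
    · rw [smul_inv_smul₀ h0]
  calc etaL L hn η k • ptL L (rhoL L hn η ρ k)
      = ptL L (etaL L hn η k • rhoL L hn η ρ k) := rfl
    _ = _ := by
      rw [h]
      ext x y
      simp only [groupedTensor, ptL, of_apply, Matrix.sum_apply]
      rfl

lemma isHermitian_ptAB {α β : Type*} {ρ : Matrix (α × β) (α × β) ℂ} (hρ : ρ.IsHermitian) :
    (ptAB ρ).IsHermitian := by
  ext p q
  exact hρ.apply _ _

lemma trace_ptAB {α β : Type*} [Fintype α] [Fintype β] (ρ : Matrix (α × β) (α × β) ℂ) :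
    (ptAB ρ).trace = ρ.trace := rfl

/-- A POVM cannot extract more than `Tr U + Tr C` from operators `D i` dominated by `U + C`. -/
lemma IsPOVM.sum_re_trace_le {ι : Type*} [Fintype ι] [DecidableEq ι] {n : ℕ}
    {M D : Fin n → Matrix ι ι ℂ} (hM : IsPOVM M) {C U : Matrix ι ι ℂ}
    (h : ∀ i, (U + C - D i).PosSemidef) :
    ∑ i, (D i * M i).trace.re ≤ U.trace.re + C.trace.re := by
  have h0 := Finset.sum_nonneg fun i (_ : i ∈ Finset.univ) => (h i).re_trace_mul_nonneg (hM.1 i)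
  simp only [Matrix.sub_mul, trace_sub, Complex.sub_re, Finset.sum_sub_distrib,
    ← Complex.re_sum, ← trace_sum, ← Matrix.mul_sum, hM.2, Matrix.mul_one, trace_add,
    Complex.add_re] at h0
  simp only [← Complex.re_sum, ← trace_sum]
  linarith

theorem stmt3 {α β : Type*} [Fintype α] [DecidableEq α] [Fintype β] [DecidableEq β]
    {n L : ℕ} (hn : 2 ≤ n) (hL : 1 ≤ L)
    (η : Fin n → ℝ) (ρ : Fin n → Matrix (α × β) (α × β) ℂ)
    (hη : ∀ i, 0 < η i) (hsum : ∑ i, η i = 1)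
    (hρ : ∀ i, (ρ i).PosSemidef ∧ (ρ i).trace = 1)
    (Q : ℝ)
    (hQ : ∀ N : Fin n → Matrix (α × β) (α × β) ℂ, IsPOVM N →
      ∑ i, η i * ((ptAB (ρ i) * N i).trace).re ≤ Q)
    (M : Fin n → Matrix (Fin L → α × β) (Fin L → α × β) ℂ) (hM : IsPOVM M) :
    ∑ i, etaL L (by omega) η i * ((ptL L (rhoL L (by omega) η ρ i) * M i).trace).re
      ≤ 1 / n + ((n - 1) / n) * (n * Q - 1) ^ L := by
  have hn0 : 0 < n := by omega
  have hnR : (n : ℝ) ≠ 0 := by positivity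
  set A : Fin n → Matrix (α × β) (α × β) ℂ := fun i => η i • ptAB (ρ i) with hAdef
  have hA : ∀ i, (A i).IsHermitian := fun i => by
    rw [IsHermitian, hAdef, conjTranspose_smul, star_trivial, isHermitian_ptAB (hρ i).1.1]
  have hne : Nonempty (α × β) := by
    by_contra hempty
    have := (hρ ⟨0, hn0⟩).2
    rw [not_nonempty_iff] at hempty
    simp [trace] at this
  obtain ⟨H, hH, hHtr⟩ := exists_upper_bound_of_povm_le hn0 hA (Q := Q) fun N hN => by
    simpa [hAdef] using hQ N hN
  have hAtr : (∑ i, A i).trace = 1 := by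
    simp only [hAdef, trace_sum, trace_smul, trace_ptAB, (hρ _).2, Complex.real_smul, mul_one]
    exact_mod_cast hsum
  have hlhs : ∀ i, etaL L hn0 η i * (ptL L (rhoL L hn0 η ρ i) * M i).trace.re
      = (groupedTensor L hn0 A i * M i).trace.re := fun i => by
    rw [← etaL_smul_ptL_rhoL L hn0 hη, Matrix.smul_mul, trace_smul, Complex.smul_re, smul_eq_mul]
  simp only [hlhs]
  refine (hM.sum_re_trace_le (C := (n : ℝ)⁻¹ • tensorFamily fun _ : Fin L => ∑ i, A i)
    (U := ((n - 1 : ℝ) / n) • tensorFamily (fun _ : Fin L => n • H - ∑ i, A i))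
    fun i => ?_).trans_eq ?_
  · have h := posSemidef_groupedTensor_bound hn hn0 hH L i (-1) (Or.inr rfl)
    convert h using 1
    module
  · have hval : (n • H - ∑ i, A i).trace = ((n * Q - 1 : ℝ) : ℂ) := by
      rw [trace_sub, trace_smul, hHtr, hAtr]
      simp
    simp only [trace_smul, trace_tensorFamily, hval, hAtr, Finset.prod_const, Finset.card_univ,
      Fintype.card_fin, Complex.smul_re, ← Complex.ofReal_pow, Complex.ofReal_re, one_pow,
      Complex.one_re, smul_eq_mul]
    ring
end

section
/- Let ι be a finite type, n ≥ 1, L ≥ 1, and let {(η i, ρ i)}_{i ∈ Fin n} be an ensemble of density matrices on Matrix ι ι ℂ with ρ i * ρ j = 0 for all i ≠ j. Then there exists a POVM M with n outcomes on the L-fold space (indexed by Fin L → ι) such that ∑ i, η_i^{(L)} * (Tr (ρ_i^{(L)} * M i)).re = 1; that is, the grouped L-fold ensemble can be perfectly discriminated by a global measurement. -/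
open Matrix BigOperators
open scoped ComplexOrder

/-- The tensor product of a finite family of matrices, indexed by functions. -/
def piKronecker {ι κ : Type*} [Fintype κ] (A : κ → Matrix ι ι ℂ) : Matrix (κ → ι) (κ → ι) ℂ :=
  Matrix.of fun x y => ∏ l, A l (x l) (y l)

section PiKronecker

variable {ι κ : Type*} [Fintype κ]

theorem piKronecker_conjTranspose (A : κ → Matrix ι ι ℂ) :
    (piKronecker A)ᴴ = piKronecker fun l => (A l)ᴴ := by
  ext x y
  simp [piKronecker, Matrix.conjTranspose_apply]

theorem piKronecker_one [DecidableEq ι] :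
    piKronecker (fun _ : κ => (1 : Matrix ι ι ℂ)) = 1 := by
  classical
  ext x y
  simp only [piKronecker, Matrix.of_apply, Matrix.one_apply, Finset.prod_ite_zero,
    Finset.prod_const_one, Finset.mem_univ, true_imp_iff, funext_iff]

theorem piKronecker_sum [DecidableEq κ] {n : ℕ} (E : Fin n → Matrix ι ι ℂ) :
    ∑ c : κ → Fin n, piKronecker (fun l => E (c l)) = piKronecker fun _ : κ => ∑ i, E i := by
  ext x y
  simp only [piKronecker, Matrix.sum_apply, Matrix.of_apply]
  rw [Finset.prod_univ_sum, Fintype.piFinset_univ]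

variable [Fintype ι] [DecidableEq κ]

theorem piKronecker_mul (A B : κ → Matrix ι ι ℂ) :
    piKronecker A * piKronecker B = piKronecker fun l => A l * B l := by
  ext x y
  simp only [piKronecker, Matrix.mul_apply, Matrix.of_apply, ← Finset.prod_mul_distrib]
  rw [Finset.prod_univ_sum, Fintype.piFinset_univ]

theorem piKronecker_trace (A : κ → Matrix ι ι ℂ) :
    (piKronecker A).trace = ∏ l, (A l).trace := by
  simp only [piKronecker, Matrix.trace, Matrix.diag, Matrix.of_apply]
  rw [Finset.prod_univ_sum, Fintype.piFinset_univ]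

open scoped MatrixOrder in
theorem piKronecker_posSemidef {A : κ → Matrix ι ι ℂ} (hA : ∀ l, (A l).PosSemidef) :
    (piKronecker A).PosSemidef := by
  classical
  choose B hB using fun l => (CStarAlgebra.nonneg_iff_eq_star_mul_self (a := A l)).1 (hA l).nonneg
  have h : piKronecker A = (piKronecker B)ᴴ * piKronecker B := by
    rw [piKronecker_conjTranspose, piKronecker_mul]
    exact congrArg piKronecker (funext hB)
  rw [h]
  exact Matrix.posSemidef_conjTranspose_mul_self _

end PiKronecker

/-- The orthogonal projection onto the range of a Hermitian matrix. -/
theorem Matrix.IsHermitian.exists_range_projection {ι : Type*} [Fintype ι] [DecidableEq ι]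
    {A : Matrix ι ι ℂ} (hA : A.IsHermitian) :
    ∃ P G : Matrix ι ι ℂ, P.IsHermitian ∧ P * P = P ∧ A * P = A ∧ P = A * G := by
  have hs : IsSelfAdjoint A := hA
  have hc : ∀ f : ℝ → ℝ, ContinuousOn f (spectrum ℝ A) := fun f =>
    (Matrix.finite_real_spectrum (A := A)).continuousOn f
  have hid : cfc (fun x : ℝ => x) A = A := cfc_id' ℝ A
  refine ⟨cfc (fun x : ℝ => x * x⁻¹) A, cfc (fun x : ℝ => x⁻¹) A, cfc_predicate _ A, ?_, ?_, ?_⟩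
  · rw [← cfc_mul _ _ A (hc _) (hc _)]
    congr 1
    ext x
    by_cases hx : x = 0 <;> simp [hx]
  · nth_rewrite 1 [← hid]
    rw [← cfc_mul _ _ A (hc _) (hc _)]
    conv_rhs => rw [← hid]
    congr 1
    ext x
    by_cases hx : x = 0 <;> simp [hx]
  · rw [cfc_mul _ _ A (hc _) (hc _), hid]

theorem Matrix.IsHermitian.posSemidef_of_mul_self {ι : Type*} [Fintype ι]
    {P : Matrix ι ι ℂ} (hP : P.IsHermitian) (hPP : P * P = P) : P.PosSemidef := by
  have h := Matrix.posSemidef_conjTranspose_mul_self P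
  rwa [hP.eq, hPP] at h

/-- Pairwise orthogonal Hermitian matrices are separated by a POVM. -/
theorem exists_isPOVM_mul_eq {ι : Type*} [Fintype ι] [DecidableEq ι] {n : ℕ} (hn : 0 < n)
    (ρ : Fin n → Matrix ι ι ℂ) (hρ : ∀ i, (ρ i).IsHermitian)
    (horth : ∀ i j, i ≠ j → ρ i * ρ j = 0) :
    ∃ E : Fin n → Matrix ι ι ℂ, IsPOVM E ∧ ∀ i j, ρ i * E j = if i = j then ρ i else 0 := by
  choose P G hP hPP hρP hG using fun i => (hρ i).exists_range_projection
  have hρP' : ∀ i j, i ≠ j → ρ i * P j = 0 := fun i j hij => by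
    rw [hG j, ← mul_assoc, horth i j hij, zero_mul]
  have hPo : ∀ i j, i ≠ j → P i * P j = 0 := fun i j hij => by
    have h : P i = (G i)ᴴ * ρ i := by
      rw [← (hP i).eq, hG i, Matrix.conjTranspose_mul, (hρ i).eq]
    rw [h, mul_assoc, hρP' i j hij, mul_zero]
  have hρsum : ∀ i, ρ i * ∑ j, P j = ρ i := fun i => by
    rw [Finset.mul_sum, Finset.sum_eq_single i (fun j _ hj => hρP' i j hj.symm) (by simp), hρP]
  have hPsum : ∀ i, P i * ∑ j, P j = P i := fun i => by
    rw [Finset.mul_sum, Finset.sum_eq_single i (fun j _ hj => hPo i j hj.symm) (by simp), hPP]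
  have hSS : (∑ j, P j) * ∑ j, P j = ∑ j, P j := by
    rw [Finset.sum_mul]
    exact Finset.sum_congr rfl fun i _ => hPsum i
  have hS : (∑ j, P j).IsHermitian := by
    simp only [Matrix.IsHermitian, Matrix.conjTranspose_sum, fun j => (hP j).eq]
  have hQ : (1 - ∑ j, P j).PosSemidef :=
    (Matrix.isHermitian_one.sub hS).posSemidef_of_mul_self (by
      rw [mul_sub, sub_mul, sub_mul, hSS]
      simp)
  refine ⟨fun i => P i + if i = ⟨0, hn⟩ then 1 - ∑ j, P j else 0, ⟨fun i => ?_, ?_⟩, fun i j => ?_⟩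
  · refine ((hP i).posSemidef_of_mul_self (hPP i)).add ?_
    split_ifs
    exacts [hQ, Matrix.PosSemidef.zero]
  · simp [Finset.sum_add_distrib]
  · have h : ρ i * (if j = ⟨0, hn⟩ then 1 - ∑ j, P j else 0) = 0 := by
      split_ifs
      · rw [mul_sub, hρsum, mul_one, sub_self]
      · exact mul_zero _
    rw [mul_add, h, add_zero]
    split_ifs with hij
    · rw [← hij, hρP]
    · exact hρP' i j hij

theorem rhoC_eq_piKronecker {ι : Type*} {n L : ℕ} (ρ : Fin n → Matrix ι ι ℂ)
    (c : Fin L → Fin n) : rhoC L ρ c = piKronecker fun l => ρ (c l) := rfl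

theorem sum_etaL {n L : ℕ} (hn : 0 < n) (η : Fin n → ℝ) :
    ∑ i, etaL L hn η i = (∑ i, η i) ^ L := by
  simp only [etaL, etaC]
  rw [Finset.sum_fiberwise, Finset.sum_pow', Fintype.piFinset_univ]

theorem stmt10 {ι : Type*} [Fintype ι] [DecidableEq ι] {n L : ℕ} (hn : 1 ≤ n) (hL : 1 ≤ L)
    (η : Fin n → ℝ) (ρ : Fin n → Matrix ι ι ℂ)
    (hη : ∀ i, 0 < η i) (hsum : ∑ i, η i = 1)
    (hρ : ∀ i, (ρ i).PosSemidef ∧ (ρ i).trace = 1)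
    (horth : ∀ i j, i ≠ j → ρ i * ρ j = 0) :
    ∃ M : Fin n → Matrix (Fin L → ι) (Fin L → ι) ℂ, IsPOVM M ∧
      ∑ i, etaL L (by omega) η i * ((rhoL L (by omega) η ρ i * M i).trace).re = 1 := by
  obtain ⟨E, ⟨hE, hE1⟩, hρE⟩ := exists_isPOVM_mul_eq hn ρ (fun i => (hρ i).1.isHermitian) horth
  have htr : ∀ c d : Fin L → Fin n,
      (rhoC L ρ c * rhoC L E d).trace = if c = d then 1 else 0 := fun c d => by
    rw [rhoC_eq_piKronecker, rhoC_eq_piKronecker, piKronecker_mul, piKronecker_trace]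
    have h : ∀ l, (ρ (c l) * E (d l)).trace = if c l = d l then 1 else 0 := fun l => by
      rw [hρE]
      split_ifs
      exacts [(hρ _).2, Matrix.trace_zero _ _]
    simp only [h, Finset.prod_ite_zero, Finset.prod_const_one, Finset.mem_univ, true_imp_iff,
      funext_iff]
  refine ⟨fun i => ∑ c ∈ Finset.univ.filter (fun c : Fin L → Fin n => omg L hn c = i), rhoC L E c,
    ⟨fun i => Matrix.posSemidef_sum _ fun c _ => piKronecker_posSemidef fun l => hE (c l), ?_⟩, ?_⟩
  · rw [Finset.sum_fiberwise]
    simp only [rhoC_eq_piKronecker]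
    rw [piKronecker_sum, hE1, piKronecker_one]
  · have key : ∀ i, etaL L hn η i * ((rhoL L hn η ρ i *
        ∑ c ∈ Finset.univ.filter (fun c : Fin L → Fin n => omg L hn c = i),
          rhoC L E c).trace).re = etaL L hn η i := fun i => by
      have h : ((∑ c ∈ Finset.univ.filter (fun c : Fin L → Fin n => omg L hn c = i),
          etaC L η c • rhoC L ρ c) *
          ∑ c ∈ Finset.univ.filter (fun c : Fin L → Fin n => omg L hn c = i),
            rhoC L E c).trace = (etaL L hn η i : ℂ) := by
        rw [Finset.sum_mul, Matrix.trace_sum, etaL, Complex.ofReal_sum]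
        refine Finset.sum_congr rfl fun c hc => ?_
        rw [Matrix.smul_mul, Matrix.trace_smul, Finset.mul_sum, Matrix.trace_sum]
        simp only [htr]
        rw [Finset.sum_ite_eq, if_pos hc]
        simp
      rw [rhoL, Matrix.smul_mul, Matrix.trace_smul, h, Complex.smul_re, Complex.ofReal_re,
        smul_eq_mul, ← mul_assoc, mul_inv_mul_cancel]
    rw [Finset.sum_congr rfl fun i _ => key i, sum_etaL, hsum, one_pow]
end
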